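/- arXiv:0909.1471 — 4 statements merged into one kernel-verified Lean document; each statement's English description precedes it below -/
import Mathlib

section
/- Let R = ℂ[[x₁,…,xₙ]] and let J ⊆ R be any ideal. Then J·Der_ℂ R (the R-submodule of Der_ℂ R consisting of finite sums Σ aᵢδᵢ with aᵢ ∈ J, δᵢ ∈ Der_ℂ R) is contained in Der_J R and is a Lie ideal of Der_J R, and reduction of derivations modulo J induces an isomorphism of Lie algebras (Der_J R)/(J·Der_ℂ R) ≅ Der_ℂ(R/J). -/
set_option synthInstance.maxHeartbeats 1000000
set_option maxHeartbeats 1000000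

/-- The Lie subalgebra `Der_J R ⊆ Der_ℂ R` of `ℂ`-linear derivations of `R`
preserving the ideal `J`. -/
noncomputable def derPres {R : Type*} [CommRing R] [Algebra ℂ R] (J : Ideal R) :
    LieSubalgebra ℂ (Derivation ℂ R R) where
  carrier := {δ | ∀ a ∈ J, δ a ∈ J}
  add_mem' := by
    intro δ ε hδ hε a ha
    simpa using J.add_mem (hδ a ha) (hε a ha)
  smul_mem' := by
    intro c δ hδ a ha
    have : (c • δ) a = c • δ a := rfl
    rw [this, Algebra.smul_def]
    exact J.mul_mem_left _ (hδ a ha)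
  zero_mem' := by intro a ha; simp
  lie_mem' := by
    intro δ ε hδ hε a ha
    rw [Derivation.commutator_apply]
    exact J.sub_mem (hδ _ (hε a ha)) (hε _ (hδ a ha))

namespace MvPowerSeries

variable {σ k : Type*} [Fintype σ]

theorem exists_eq_sum_X_mul [CommRing k] {f : MvPowerSeries σ k} (hf : constantCoeff f = 0) :
    ∃ g : σ → MvPowerSeries σ k, f = ∑ i, X i * g i := by
  classical
  have hc : ∀ d : σ →₀ ℕ, ∃ i : Option σ, (d = 0 ∧ i = none) ∨ ∃ j, i = some j ∧ d j ≠ 0 := by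
    intro d
    by_cases hd : d = 0
    · exact ⟨none, .inl ⟨hd, rfl⟩⟩
    · obtain ⟨j, hj⟩ := Finsupp.ne_iff.1 hd
      exact ⟨some j, .inr ⟨j, rfl, hj⟩⟩
  choose c hc using hc
  let g : σ → MvPowerSeries σ k := fun i e ↦
    if c (e + Finsupp.single i 1) = some i then coeff (e + Finsupp.single i 1) f else 0
  have hg : ∀ d i, coeff d (X i * g i) = if c d = some i then coeff d f else 0 := by
    intro d i
    rw [X, coeff_monomial_mul]
    by_cases hi : Finsupp.single i 1 ≤ d
    · rw [if_pos hi, one_mul]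
      change (if c (d - Finsupp.single i 1 + Finsupp.single i 1) = some i then
        coeff (d - Finsupp.single i 1 + Finsupp.single i 1) f else 0) = _
      rw [tsub_add_cancel_of_le hi]
    · rw [if_neg hi, if_neg]
      intro h
      obtain ⟨-, h'⟩ | ⟨j, hj, hd⟩ := hc d
      · simp [h] at h'
      · obtain rfl : i = j := Option.some_injective _ (h.symm.trans hj)
        exact hi (Finsupp.single_le_iff.2 (Nat.one_le_iff_ne_zero.2 hd))
  refine ⟨g, ext fun d ↦ ?_⟩
  rw [map_sum]
  simp_rw [hg]
  obtain ⟨rfl, h⟩ | ⟨j, hj, -⟩ := hc d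
  · simpa [h] using hf
  · simp [hj]

variable [Field k] {M : Type*} [AddCommGroup M] [Module (MvPowerSeries σ k) M] [Module k M]

theorem derivation_eq_zero_of_X [Module.Finite (MvPowerSeries σ k) M]
    {D : Derivation k (MvPowerSeries σ k) M} (hD : ∀ i, D (X i) = 0) : D = 0 := by
  let I : Ideal (MvPowerSeries σ k) := Ideal.span (Set.range X)
  have hI : I ≠ ⊤ := by
    refine ne_top_of_le_ne_top (RingHom.ker_ne_top (constantCoeff (σ := σ) (R := k))) ?_
    rw [Ideal.span_le]
    rintro _ ⟨i, rfl⟩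
    simp
  have hmem : ∀ (m : ℕ) f, D f ∈ (I ^ m • ⊤ : Submodule (MvPowerSeries σ k) M) := by
    intro m
    induction m with
    | zero => simp
    | succ m ih =>
      intro f
      obtain ⟨g, hg⟩ := exists_eq_sum_X_mul (f := f - C (constantCoeff f)) (by simp)
      have hC : D (C (constantCoeff f)) = 0 := D.map_algebraMap _
      rw [← sub_zero (D f), ← hC, ← map_sub, hg, map_sum]
      refine Submodule.sum_mem _ fun i _ ↦ ?_
      rw [D.leibniz, hD, smul_zero, add_zero, pow_succ', Submodule.mul_smul]
      exact Submodule.smul_mem_smul (Ideal.subset_span ⟨i, rfl⟩) (ih _)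
  ext f
  exact (IsHausdorff.of_isLocalRing I M hI).haus _ fun m ↦ SModEq.zero.2 (hmem m f)

theorem derivation_ext_X [Module.Finite (MvPowerSeries σ k) M]
    {D₁ D₂ : Derivation k (MvPowerSeries σ k) M} (h : ∀ i, D₁ (X i) = D₂ (X i)) : D₁ = D₂ :=
  sub_eq_zero.1 <| derivation_eq_zero_of_X fun i ↦ by simp [h i]

theorem sum_smul_pderiv_X (a : σ → MvPowerSeries σ k) (j : σ) :
    (∑ i, a i • pderiv k i) (X j) = a j := by
  classical
  rw [← Derivation.coeFnAddMonoidHom_apply, map_sum, Finset.sum_apply]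
  simp [pderiv_X, Pi.single_apply]

theorem derivation_eq_sum_smul_pderiv (D : Derivation k (MvPowerSeries σ k) (MvPowerSeries σ k)) :
    D = ∑ i, D (X i) • pderiv k i :=
  derivation_ext_X fun i ↦ (sum_smul_pderiv_X (fun i ↦ D (X i)) i).symm

end MvPowerSeries

section

variable {R : Type*} [CommRing R] [Algebra ℂ R] {J : Ideal R}

theorem derivation_apply_mem_of_mem_smul_top {δ : Derivation ℂ R R}
    (hδ : δ ∈ (J • ⊤ : Submodule R (Derivation ℂ R R))) (a : R) : δ a ∈ J := by
  induction hδ using Submodule.smul_induction_on' with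
  | smul r hr D _ => exact J.mul_mem_right _ hr
  | add D _ E _ hD hE => exact J.add_mem hD hE

theorem lie_mem_smul_top_of_mem_derPres {δ η : Derivation ℂ R R} (hδ : δ ∈ derPres J)
    (hη : η ∈ (J • ⊤ : Submodule R (Derivation ℂ R R))) :
    ⁅δ, η⁆ ∈ (J • ⊤ : Submodule R (Derivation ℂ R R)) := by
  induction hη using Submodule.smul_induction_on' with
  | smul r hr D _ =>
    have h : ⁅δ, r • D⁆ = δ r • D + r • ⁅δ, D⁆ := by
      ext a
      simp only [Derivation.commutator_apply, Derivation.add_apply, Derivation.smul_apply,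
        smul_eq_mul, Derivation.leibniz]
      ring
    rw [h]
    exact add_mem (Submodule.smul_mem_smul (hδ r hr) trivial)
      (Submodule.smul_mem_smul hr trivial)
  | add D _ E _ hD hE =>
    rw [lie_add]
    exact add_mem hD hE

/-- The derivation of `R ⧸ J` induced by a derivation of `R` preserving `J`. -/
noncomputable def derPresQuotient (δ : derPres J) : Derivation ℂ (R ⧸ J) (R ⧸ J) :=
  Derivation.liftOfSurjective (f := Ideal.Quotient.mkₐ ℂ J) (Ideal.Quotient.mkₐ_surjective ℂ J)
    (d := δ) fun x hx ↦ Ideal.Quotient.eq_zero_iff_mem.2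
      (δ.2 x (Ideal.Quotient.eq_zero_iff_mem.1 hx))

theorem derPresQuotient_mk (δ : derPres J) (a : R) :
    derPresQuotient δ (Ideal.Quotient.mk J a) =
      Ideal.Quotient.mk J ((δ : Derivation ℂ R R) a) :=
  Derivation.liftOfSurjective_apply (f := Ideal.Quotient.mkₐ ℂ J)
    (Ideal.Quotient.mkₐ_surjective ℂ J) (fun x hx ↦ Ideal.Quotient.eq_zero_iff_mem.2
      (δ.2 x (Ideal.Quotient.eq_zero_iff_mem.1 hx))) a

theorem derivation_quotient_ext {D E : Derivation ℂ (R ⧸ J) (R ⧸ J)}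
    (h : ∀ a, D (Ideal.Quotient.mk J a) = E (Ideal.Quotient.mk J a)) : D = E := by
  ext x
  obtain ⟨a, rfl⟩ := Ideal.Quotient.mk_surjective x
  exact h a

/-- Reduction modulo `J` as a Lie algebra homomorphism `Der_J R → Der_ℂ (R ⧸ J)`. -/
noncomputable def derPresQuotientHom (J : Ideal R) :
    derPres J →ₗ⁅ℂ⁆ Derivation ℂ (R ⧸ J) (R ⧸ J) where
  toFun := derPresQuotient
  map_add' δ ε := derivation_quotient_ext fun a ↦ by
    simp [derPresQuotient_mk]
  map_smul' c δ := derivation_quotient_ext fun a ↦ by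
    simp only [derPresQuotient_mk, RingHom.id_apply, Derivation.smul_apply]
    exact map_smul (Ideal.Quotient.mkₐ ℂ J) c _
  map_lie' {δ ε} := derivation_quotient_ext fun a ↦ by
    simp [derPresQuotient_mk, Derivation.commutator_apply]

theorem derPresQuotientHom_mk (δ : derPres J) (a : R) :
    derPresQuotientHom J δ (Ideal.Quotient.mk J a) =
      Ideal.Quotient.mk J ((δ : Derivation ℂ R R) a) :=
  derPresQuotient_mk δ a

theorem derPresQuotientHom_eq_zero_iff {δ : derPres J} :
    derPresQuotientHom J δ = 0 ↔ ∀ a, (δ : Derivation ℂ R R) a ∈ J := by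
  simp only [← Ideal.Quotient.eq_zero_iff_mem, ← derPresQuotientHom_mk]
  exact ⟨fun h a ↦ by rw [h, Derivation.zero_apply], fun h ↦ derivation_quotient_ext h⟩

end

namespace MvPowerSeries

variable {σ : Type*} [Fintype σ] {J : Ideal (MvPowerSeries σ ℂ)}

theorem mem_smul_top_of_derivation_apply_mem
    {δ : Derivation ℂ (MvPowerSeries σ ℂ) (MvPowerSeries σ ℂ)} (h : ∀ a, δ a ∈ J) :
    δ ∈ (J • ⊤ : Submodule (MvPowerSeries σ ℂ)
      (Derivation ℂ (MvPowerSeries σ ℂ) (MvPowerSeries σ ℂ))) := by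
  rw [derivation_eq_sum_smul_pderiv δ]
  exact Submodule.sum_mem _ fun i _ ↦ Submodule.smul_mem_smul (h _) trivial

theorem derPresQuotientHom_surjective : Function.Surjective (derPresQuotientHom J) := by
  intro D
  choose a ha using fun i : σ ↦ Ideal.Quotient.mk_surjective (D (Ideal.Quotient.mk J (X i)))
  let δ : Derivation ℂ (MvPowerSeries σ ℂ) (MvPowerSeries σ ℂ) := ∑ i, a i • pderiv ℂ i
  have hδ : (Submodule.mkQ J).compDer δ = D.compAlgebraMap (MvPowerSeries σ ℂ) := by
    refine derivation_ext_X fun i ↦ ?_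
    change Ideal.Quotient.mk J (δ (X i)) = D (Ideal.Quotient.mk J (X i))
    rw [sum_smul_pderiv_X, ha]
  have hδ' : ∀ f, Ideal.Quotient.mk J (δ f) = D (Ideal.Quotient.mk J f) :=
    fun f ↦ DFunLike.congr_fun hδ f
  refine ⟨⟨δ, fun f hf ↦ ?_⟩, derivation_quotient_ext fun f ↦ ?_⟩
  · rw [← Ideal.Quotient.eq_zero_iff_mem, hδ', Ideal.Quotient.eq_zero_iff_mem.2 hf, map_zero]
  · rw [derPresQuotientHom_mk, hδ']

end MvPowerSeries

/-- For any ideal `J` of `R = ℂ[[x₁,…,xₙ]]`, the `R`-submodule `J·Der_ℂ R` is contained in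
`Der_J R` and is a Lie ideal of `Der_J R`, and reduction of derivations modulo `J`
(namely `δ ↦ δ̄` with `δ̄(a + J) = δ(a) + J`) is a surjective Lie algebra homomorphism
`Der_J R → Der_ℂ(R/J)` with kernel exactly `J·Der_ℂ R`; hence it induces an isomorphism
of Lie algebras `(Der_J R)/(J·Der_ℂ R) ≅ Der_ℂ(R/J)`. -/
theorem derPres_quotient_iso_derivation
    (n : ℕ) (J : Ideal (MvPowerSeries (Fin n) ℂ)) :
    -- `J·Der_ℂ R ⊆ Der_J R`
    (∀ δ : Derivation ℂ (MvPowerSeries (Fin n) ℂ) (MvPowerSeries (Fin n) ℂ),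
      δ ∈ (J • ⊤ : Submodule (MvPowerSeries (Fin n) ℂ)
        (Derivation ℂ (MvPowerSeries (Fin n) ℂ) (MvPowerSeries (Fin n) ℂ))) → δ ∈ derPres J) ∧
    -- `J·Der_ℂ R` is a Lie ideal of `Der_J R`
    (∀ δ : Derivation ℂ (MvPowerSeries (Fin n) ℂ) (MvPowerSeries (Fin n) ℂ), δ ∈ derPres J →
      ∀ η : Derivation ℂ (MvPowerSeries (Fin n) ℂ) (MvPowerSeries (Fin n) ℂ),
        η ∈ (J • ⊤ : Submodule (MvPowerSeries (Fin n) ℂ)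
          (Derivation ℂ (MvPowerSeries (Fin n) ℂ) (MvPowerSeries (Fin n) ℂ))) →
        ⁅δ, η⁆ ∈ (J • ⊤ : Submodule (MvPowerSeries (Fin n) ℂ)
          (Derivation ℂ (MvPowerSeries (Fin n) ℂ) (MvPowerSeries (Fin n) ℂ)))) ∧
    -- reduction modulo `J` is a surjective Lie algebra homomorphism with kernel `J·Der_ℂ R`
    (∃ φ : derPres J →ₗ⁅ℂ⁆
        Derivation ℂ (MvPowerSeries (Fin n) ℂ ⧸ J) (MvPowerSeries (Fin n) ℂ ⧸ J),
      (∀ (δ : derPres J) (a : MvPowerSeries (Fin n) ℂ),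
        φ δ (Ideal.Quotient.mk J a) =
          Ideal.Quotient.mk J ((δ : Derivation ℂ (MvPowerSeries (Fin n) ℂ)
            (MvPowerSeries (Fin n) ℂ)) a)) ∧
      Function.Surjective φ ∧
      (∀ δ : derPres J, φ δ = 0 ↔
        (δ : Derivation ℂ (MvPowerSeries (Fin n) ℂ) (MvPowerSeries (Fin n) ℂ)) ∈
          (J • ⊤ : Submodule (MvPowerSeries (Fin n) ℂ)
            (Derivation ℂ (MvPowerSeries (Fin n) ℂ) (MvPowerSeries (Fin n) ℂ))))) := by
  refine ⟨fun δ hδ a _ ↦ derivation_apply_mem_of_mem_smul_top hδ a,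
    fun δ hδ η hη ↦ lie_mem_smul_top_of_mem_derPres hδ hη,
    derPresQuotientHom J, derPresQuotientHom_mk, MvPowerSeries.derPresQuotientHom_surjective,
    fun δ ↦ derPresQuotientHom_eq_zero_iff.trans
      ⟨MvPowerSeries.mem_smul_top_of_derivation_apply_mem,
        derivation_apply_mem_of_mem_smul_top⟩⟩
end

section
/- Let R = ℂ[[x₁,…,xₙ]] with maximal ideal 𝔪 = (x₁,…,xₙ), and let i ≥ 2 be an integer. Then a ℂ-linear derivation δ of R satisfies δ(𝔪) ⊆ 𝔪 if and only if δ(𝔪^i) ⊆ 𝔪^i; i.e., Der_𝔪 R = Der_{𝔪^i} R for all i ≥ 2. -/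
set_option synthInstance.maxHeartbeats 1000000
set_option maxHeartbeats 1000000

open MvPowerSeries in
/-- A power series all of whose monomials involve a variable from the finite set `s` lies in the
ideal generated by the variables. -/
theorem MvPowerSeries.mem_span_X_of_coeff_eq_zero {σ R : Type*} [CommRing R] (s : Finset σ)
    (f : MvPowerSeries σ R) (hf : ∀ m : σ →₀ ℕ, (∀ j ∈ s, m j = 0) → coeff m f = 0) :
    f ∈ Ideal.span (Set.range (X : σ → MvPowerSeries σ R)) := by
  classical
  induction s using Finset.induction_on generalizing f with
  | empty =>
    have : f = 0 := by
      ext m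
      simpa using hf m (by simp)
    simp [this]
  | insert a s _ ih =>
    let h : MvPowerSeries σ R := fun m => if m a = 0 then coeff m f else 0
    have coeff_h (m : σ →₀ ℕ) : coeff m h = if m a = 0 then coeff m f else 0 := rfl
    have hh : h ∈ Ideal.span (Set.range (X : σ → MvPowerSeries σ R)) := by
      refine ih h fun m hm => ?_
      rw [coeff_h]
      split_ifs with hma
      · exact hf m (by simpa [hma] using hm)
      · rfl
    have hdvd : X a ∣ f - h := by
      rw [X_dvd_iff]
      intro m hm
      simp [coeff_h, hm]
    have hg := Ideal.mem_of_dvd _ hdvd (Ideal.subset_span (Set.mem_range_self a))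
    simpa using add_mem hg hh

open MvPowerSeries in
theorem MvPowerSeries.mem_span_X_iff_constantCoeff_eq_zero {σ R : Type*} [CommRing R] [Finite σ]
    {f : MvPowerSeries σ R} :
    f ∈ Ideal.span (Set.range (X : σ → MvPowerSeries σ R)) ↔ constantCoeff f = 0 := by
  cases nonempty_fintype σ
  constructor
  · intro hf
    have hle : Ideal.span (Set.range (X : σ → MvPowerSeries σ R)) ≤
        RingHom.ker (constantCoeff (σ := σ) (R := R)) := by
      rw [Ideal.span_le]
      rintro _ ⟨j, rfl⟩
      simp
    exact hle hf
  · intro hf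
    refine mem_span_X_of_coeff_eq_zero Finset.univ f fun m hm => ?_
    have : m = 0 := by
      ext j
      exact hm j (Finset.mem_univ j)
    rw [this, coeff_zero_eq_constantCoeff_apply, hf]

open MvPowerSeries in
theorem MvPowerSeries.le_order_of_mem_span_X_pow {σ R : Type*} [CommRing R] [Finite σ] (k : ℕ)
    {f : MvPowerSeries σ R} (hf : f ∈ Ideal.span (Set.range (X : σ → MvPowerSeries σ R)) ^ k) :
    (k : ℕ∞) ≤ f.order := by
  induction k generalizing f with
  | zero => simp
  | succ k ih =>
    rw [pow_succ] at hf
    induction hf using Submodule.mul_induction_on' with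
    | mem_mul_mem a ha b hb =>
      have hb' : 1 ≤ b.order :=
        one_le_order_iff_constCoeff_eq_zero.mpr (mem_span_X_iff_constantCoeff_eq_zero.mp hb)
      push_cast
      exact (add_le_add (ih ha) hb').trans le_order_mul
    | add a _ b _ ha hb => exact (le_min ha hb).trans min_order_le_add

/-- A derivation preserving an ideal preserves all its powers. -/
theorem Derivation.apply_mem_pow {R A : Type*} [CommRing R] [CommRing A] [Algebra R A]
    (δ : Derivation R A A) {I : Ideal A} (h : ∀ a ∈ I, δ a ∈ I) (k : ℕ) {a : A}
    (ha : a ∈ I ^ k) : δ a ∈ I ^ k := by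
  induction k generalizing a with
  | zero => simp
  | succ k ih =>
    rw [pow_succ] at ha ⊢
    induction ha using Submodule.mul_induction_on' with
    | mem_mul_mem a ha b hb =>
      rw [Derivation.leibniz, smul_eq_mul, smul_eq_mul, mul_comm b]
      exact add_mem (Ideal.mul_mem_mul ha (h b hb)) (Ideal.mul_mem_mul (ih ha) hb)
    | add a _ b _ ha hb =>
      rw [map_add]
      exact add_mem ha hb

/-- Let `R = ℂ[[x₁,…,xₙ]]` with maximal ideal `𝔪 = (x₁,…,xₙ)` and let `i ≥ 2`. A `ℂ`-linear
derivation `δ` of `R` preserves `𝔪` if and only if it preserves `𝔪^i`;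
i.e. `Der_𝔪 R = Der_{𝔪^i} R` for all `i ≥ 2`. -/
theorem derivation_preserves_maximal_iff_preserves_pow
    (n : ℕ)
    (𝔪 : Ideal (MvPowerSeries (Fin n) ℂ))
    (h𝔪 : 𝔪 = Ideal.span (Set.range (MvPowerSeries.X : Fin n → MvPowerSeries (Fin n) ℂ)))
    (i : ℕ) (hi : 2 ≤ i)
    (δ : Derivation ℂ (MvPowerSeries (Fin n) ℂ) (MvPowerSeries (Fin n) ℂ)) :
    (∀ a ∈ 𝔪, δ a ∈ 𝔪) ↔ (∀ a ∈ 𝔪 ^ i, δ a ∈ 𝔪 ^ i) := by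
  subst h𝔪
  refine ⟨fun h a ha => δ.apply_mem_pow h i ha, fun h => ?_⟩
  have hX (j : Fin n) : δ (MvPowerSeries.X j) ∈
      Ideal.span (Set.range (MvPowerSeries.X : Fin n → MvPowerSeries (Fin n) ℂ)) := by
    rw [MvPowerSeries.mem_span_X_iff_constantCoeff_eq_zero]
    by_contra hc
    have hle := MvPowerSeries.le_order_of_mem_span_X_pow i
      (h _ (Ideal.pow_mem_pow (Ideal.subset_span (Set.mem_range_self j)) i))
    have hcoeff := MvPowerSeries.coeff_of_lt_order (d := Finsupp.single j (i - 1))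
      (lt_of_lt_of_le (by rw [Finsupp.degree_single]; exact_mod_cast (by omega : i - 1 < i)) hle)
    rw [Derivation.leibniz_pow, map_nsmul, smul_eq_mul, MvPowerSeries.X_pow_eq] at hcoeff
    have hmul := MvPowerSeries.coeff_add_monomial_mul (Finsupp.single j (i - 1)) 0
      (δ (MvPowerSeries.X j)) (1 : ℂ)
    rw [add_zero, one_mul, MvPowerSeries.coeff_zero_eq_constantCoeff_apply] at hmul
    rw [hmul, nsmul_eq_mul, mul_eq_zero, Nat.cast_eq_zero] at hcoeff
    exact hcoeff.elim (by omega) hc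
  intro a ha
  induction ha using Submodule.span_induction with
  | mem x hx =>
    obtain ⟨j, rfl⟩ := hx
    exact hX j
  | zero => simp
  | add x y _ _ hx hy =>
    rw [map_add]
    exact add_mem hx hy
  | smul r x hx ih =>
    rw [smul_eq_mul, Derivation.leibniz, smul_eq_mul, smul_eq_mul]
    exact add_mem (Ideal.mul_mem_left _ _ ih) (Ideal.mul_mem_right _ _ hx)
end

section
/- Let R = ℂ[[x₁,…,xₙ]] with maximal ideal 𝔪 = (x₁,…,xₙ), let I ⊆ R be an ideal with 𝔪^ℓ ⊆ I ⊆ 𝔪 for some ℓ ≥ 2, and set R̄ = R/𝔪^{ℓ+1} with 𝔪̄ and Ī the images of 𝔪 and I in R̄. Then every ℂ-linear derivation δ of R̄ with δ(Ī) ⊆ Ī also satisfies δ(𝔪̄·Ī) ⊆ 𝔪̄·Ī; i.e., Der_{Ī} R̄ ⊆ Der_{𝔪̄·Ī} R̄. -/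
set_option synthInstance.maxHeartbeats 1000000
set_option maxHeartbeats 1000000

namespace MvPowerSeries

variable {σ R : Type*} [CommRing R]

theorem mem_span_X_image_of_coeff_eq_zero (s : Finset σ) {f : MvPowerSeries σ R}
    (hf : ∀ d : σ →₀ ℕ, (∀ i ∈ s, d i = 0) → coeff d f = 0) :
    f ∈ Ideal.span ((X : σ → MvPowerSeries σ R) '' s) := by
  classical
  induction s using Finset.induction_on generalizing f with
  | empty =>
    have : f = 0 := ext fun d => by simpa using hf d (by simp)
    simp [this]
  | insert a s _ ih =>
    let g : MvPowerSeries σ R := fun d => if d a = 0 then coeff d f else 0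
    have coeff_g (d : σ →₀ ℕ) : coeff d g = if d a = 0 then coeff d f else 0 := rfl
    have hg : g ∈ Ideal.span ((X : σ → MvPowerSeries σ R) '' s) := by
      refine ih fun d hd => ?_
      rw [coeff_g]
      split_ifs with h
      · exact hf d (by simpa [h] using hd)
      · rfl
    have hfg : X a ∣ f - g := by
      rw [X_dvd_iff]
      intro d hd
      simp [coeff_g, hd]
    rw [← sub_add_cancel f g]
    refine add_mem ?_ (Ideal.span_mono (Set.image_mono (by simp)) hg)
    exact Ideal.mem_of_dvd _ hfg (Ideal.subset_span ⟨a, by simp⟩)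

theorem span_range_X_eq_ker_constantCoeff [Finite σ] :
    Ideal.span (Set.range (X : σ → MvPowerSeries σ R)) =
      RingHom.ker (constantCoeff : MvPowerSeries σ R →+* R) := by
  apply le_antisymm
  · rw [Ideal.span_le]
    rintro _ ⟨i, rfl⟩
    simp [RingHom.mem_ker]
  · intro f hf
    cases nonempty_fintype σ
    have := mem_span_X_image_of_coeff_eq_zero (f := f) Finset.univ fun d hd => by
      obtain rfl : d = 0 := Finsupp.ext fun i => hd i (Finset.mem_univ i)
      simpa using hf
    simpa using this

theorem le_order_of_mem_ker_constantCoeff_pow {k : ℕ} {f : MvPowerSeries σ R}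
    (hf : f ∈ RingHom.ker (constantCoeff : MvPowerSeries σ R →+* R) ^ k) : k ≤ f.order := by
  induction k generalizing f with
  | zero => simp
  | succ k ih =>
    rw [pow_succ] at hf
    refine Submodule.mul_induction_on hf (fun g hg h hh => ?_) fun g h hg hh =>
      (le_min hg hh).trans min_order_le_add
    refine le_trans ?_ le_order_mul
    push_cast
    exact add_le_add (ih hg) (one_le_order_iff_constCoeff_eq_zero.mpr hh)

theorem X_pow_notMem_ker_constantCoeff_pow_succ [Nontrivial R] (i : σ) (k : ℕ) :
    (X i : MvPowerSeries σ R) ^ k ∉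
      RingHom.ker (constantCoeff : MvPowerSeries σ R →+* R) ^ (k + 1) := by
  intro h
  have h := le_order_of_mem_ker_constantCoeff_pow h
  rw [X_pow_eq, order_monomial_of_ne_zero one_ne_zero, Finsupp.degree_single] at h
  exact absurd h (by norm_cast; simp)

end MvPowerSeries

theorem Derivation.apply_mem_mul {k A : Type*} [CommRing k] [CommRing A] [Algebra k A]
    (δ : Derivation k A A) {I J : Ideal A} (hI : ∀ a ∈ I, δ a ∈ I) (hJ : ∀ a ∈ J, δ a ∈ J) :
    ∀ a ∈ I * J, δ a ∈ I * J := by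
  intro a ha
  refine Submodule.mul_induction_on ha (fun x hx y hy => ?_) fun x y hx hy => ?_
  · rw [δ.leibniz, smul_eq_mul, smul_eq_mul, mul_comm y]
    exact add_mem (Ideal.mul_mem_mul hx (hJ y hy)) (Ideal.mul_mem_mul (hI x hx) hy)
  · rw [map_add]
    exact add_mem hx hy

theorem Derivation.apply_mem_span {k A : Type*} [CommRing k] [CommRing A] [Algebra k A]
    (δ : Derivation k A A) {s : Set A} (hs : ∀ a ∈ s, δ a ∈ Ideal.span s) :
    ∀ a ∈ Ideal.span s, δ a ∈ Ideal.span s := by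
  intro a ha
  induction ha using Submodule.span_induction with
  | mem x hx => exact hs x hx
  | zero => simp
  | add x y _ _ hx hy => simpa using add_mem hx hy
  | smul r x hx hδ =>
    rw [smul_eq_mul, δ.leibniz, smul_eq_mul, smul_eq_mul]
    exact add_mem (Ideal.mul_mem_left _ _ hδ) (Ideal.mul_mem_right _ _ hx)

theorem Derivation.not_isUnit_of_pow_succ_eq_zero {k A : Type*} [CommRing k] [CommRing A]
    [Algebra k A] [Algebra ℚ A] (δ : Derivation k A A) {x : A} {m : ℕ}
    (hx : x ^ (m + 1) = 0) (hx' : x ^ m ≠ 0) : ¬ IsUnit (δ x) := by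
  intro hu
  have h := δ.leibniz_pow x (m + 1)
  rw [hx, map_zero, Nat.add_sub_cancel, smul_eq_mul, ← Nat.cast_smul_eq_nsmul ℚ, eq_comm,
    smul_eq_zero_iff_right (by positivity), hu.mul_left_eq_zero] at h
  exact hx' h

/-- A derivation of the truncated power series ring preserves its maximal ideal. -/
theorem MvPowerSeries.derivation_apply_mem_map_ker_constantCoeff {σ k : Type*} [Finite σ]
    [Field k] [CharZero k] {m : ℕ} {𝔪 : Ideal (MvPowerSeries σ k)}
    (h𝔪 : 𝔪 = Ideal.span (Set.range (X : σ → MvPowerSeries σ k)))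
    (δ : Derivation k (MvPowerSeries σ k ⧸ 𝔪 ^ (m + 1)) (MvPowerSeries σ k ⧸ 𝔪 ^ (m + 1))) :
    ∀ a ∈ 𝔪.map (Ideal.Quotient.mk (𝔪 ^ (m + 1))),
      δ a ∈ 𝔪.map (Ideal.Quotient.mk (𝔪 ^ (m + 1))) := by
  have h𝔪' := h𝔪.trans span_range_X_eq_ker_constantCoeff
  have hspan : 𝔪.map (Ideal.Quotient.mk (𝔪 ^ (m + 1))) = Ideal.span
      (Ideal.Quotient.mk (𝔪 ^ (m + 1)) '' Set.range (X : σ → MvPowerSeries σ k)) := by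
    rw [← Ideal.map_span, ← h𝔪]
  rw [hspan]
  apply δ.apply_mem_span
  rw [← hspan]
  rintro _ ⟨_, ⟨i, rfl⟩, rfl⟩
  have hX : X i ∈ 𝔪 := by simp [h𝔪', RingHom.mem_ker]
  have hu := δ.not_isUnit_of_pow_succ_eq_zero (x := Ideal.Quotient.mk (𝔪 ^ (m + 1)) (X i)) (m := m)
    (by rw [← map_pow, Ideal.Quotient.eq_zero_iff_mem]; exact Ideal.pow_mem_pow hX _)
    (by
      rw [← map_pow, Ne, Ideal.Quotient.eq_zero_iff_mem, h𝔪']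
      exact X_pow_notMem_ker_constantCoeff_pow_succ i m)
  obtain ⟨f, hf⟩ := Ideal.Quotient.mk_surjective (δ (Ideal.Quotient.mk (𝔪 ^ (m + 1)) (X i)))
  rw [← hf] at hu ⊢
  apply Ideal.mem_map_of_mem
  rw [h𝔪', RingHom.mem_ker]
  by_contra hc
  exact hu ((isUnit_iff_constantCoeff.mpr (isUnit_iff_ne_zero.mpr hc)).map _)

/-- Let `R = ℂ[[x₁,…,xₙ]]` with maximal ideal `𝔪`, `𝔪^ℓ ⊆ I ⊆ 𝔪` with `ℓ ≥ 2`,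
`R̄ = R/𝔪^{ℓ+1}`, `𝔪̄` and `Ī` the images of `𝔪` and `I` in `R̄`. Then every `ℂ`-linear
derivation of `R̄` preserving `Ī` also preserves `𝔪̄·Ī`; i.e. `Der_Ī R̄ ⊆ Der_{𝔪̄·Ī} R̄`. -/
theorem derivation_preserves_mul_of_preserves
    (n : ℕ)
    (𝔪 : Ideal (MvPowerSeries (Fin n) ℂ))
    (h𝔪 : 𝔪 = Ideal.span (Set.range (MvPowerSeries.X : Fin n → MvPowerSeries (Fin n) ℂ)))
    (I : Ideal (MvPowerSeries (Fin n) ℂ))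
    (ℓ : ℕ) (hℓ : 2 ≤ ℓ) (hℓI : 𝔪 ^ ℓ ≤ I) (hI𝔪 : I ≤ 𝔪)
    (δ : Derivation ℂ (MvPowerSeries (Fin n) ℂ ⧸ 𝔪 ^ (ℓ + 1))
      (MvPowerSeries (Fin n) ℂ ⧸ 𝔪 ^ (ℓ + 1)))
    (hδ : ∀ a ∈ I.map (Ideal.Quotient.mk (𝔪 ^ (ℓ + 1))), δ a ∈
      I.map (Ideal.Quotient.mk (𝔪 ^ (ℓ + 1)))) :
    ∀ a ∈ (𝔪.map (Ideal.Quotient.mk (𝔪 ^ (ℓ + 1)))) * (I.map (Ideal.Quotient.mk (𝔪 ^ (ℓ + 1)))),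
      δ a ∈ (𝔪.map (Ideal.Quotient.mk (𝔪 ^ (ℓ + 1)))) * (I.map (Ideal.Quotient.mk (𝔪 ^ (ℓ + 1)))) := by
  exact δ.apply_mem_mul
    (MvPowerSeries.derivation_apply_mem_map_ker_constantCoeff h𝔪 δ) hδ
end

section
/- Let R = ℂ[[x₁,…,xₙ]] with maximal ideal 𝔪 = (x₁,…,xₙ), let ℓ ≥ 2, and set R̄ = R/𝔪^{ℓ+1} with 𝔪̄ the image of 𝔪 in R̄. Then every ℂ-linear derivation δ of R̄ satisfies δ(𝔪̄^i) ⊆ 𝔪̄^i for all i ≥ 1; i.e., Der_ℂ R̄ = Der_{𝔪̄^i} R̄ for all i ≥ 1. -/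
set_option synthInstance.maxHeartbeats 1000000
set_option maxHeartbeats 1000000

/-- A multivariate power series all of whose monomials involve a variable in the finite set `s`
lies in the ideal generated by those variables. -/
theorem MvPowerSeries.mem_span_X_image_of_coeff_eq_zero_s12 {σ R : Type*} [CommRing R]
    (s : Finset σ) (f : MvPowerSeries σ R)
    (hf : ∀ d : σ →₀ ℕ, (∀ i ∈ s, d i = 0) → coeff d f = 0) :
    f ∈ Ideal.span ((X : σ → MvPowerSeries σ R) '' s) := by
  classical
  induction s using Finset.induction_on generalizing f with
  | empty =>
    have : f = 0 := by
      ext d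
      simpa using hf d (by simp)
    simp [this]
  | insert a s _ ih =>
    let h : MvPowerSeries σ R := fun d => if d a = 0 then coeff d f else 0
    have hh : ∀ d, coeff d h = if d a = 0 then coeff d f else 0 := fun _ => rfl
    have h₁ : h ∈ Ideal.span ((X : σ → MvPowerSeries σ R) '' s) := by
      refine ih h fun d hd => ?_
      rw [hh]
      split_ifs with h0
      · refine hf d fun i hi => ?_
        rcases Finset.mem_insert.mp hi with rfl | hi
        · exact h0
        · exact hd i hi
      · rfl
    have h₂ : (X a : MvPowerSeries σ R) ∣ f - h := by
      rw [X_dvd_iff]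
      intro d hd
      simp [hh, hd]
    rw [← sub_add_cancel f h]
    refine Ideal.add_mem _ (Ideal.mem_of_dvd _ h₂ (Ideal.subset_span ⟨a, by simp, rfl⟩)) ?_
    exact Ideal.span_mono (Set.image_mono (by simp)) h₁

/-- In finitely many variables, a power series with zero constant coefficient lies in the ideal
generated by the variables. -/
theorem MvPowerSeries.mem_span_range_X_of_constantCoeff_eq_zero {σ R : Type*} [Finite σ]
    [CommRing R] {f : MvPowerSeries σ R} (hf : constantCoeff f = 0) :
    f ∈ Ideal.span (Set.range (X : σ → MvPowerSeries σ R)) := by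
  have := Fintype.ofFinite σ
  have key := mem_span_X_image_of_coeff_eq_zero_s12 Finset.univ f fun d hd => by
    have : d = 0 := Finsupp.ext fun i => hd i (Finset.mem_univ i)
    rw [this]
    exact hf
  simpa using key

/-- Elements of the `k`-th power of the ideal generated by the variables have order at least
`k`. -/
theorem MvPowerSeries.le_order_of_mem_span_range_X_pow {σ R : Type*} [CommRing R] (k : ℕ)
    {f : MvPowerSeries σ R}
    (hf : f ∈ Ideal.span (Set.range (X : σ → MvPowerSeries σ R)) ^ k) :
    (k : ℕ∞) ≤ f.order := by
  induction k generalizing f with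
  | zero => simp
  | succ k ih =>
    rw [pow_succ] at hf
    refine Submodule.mul_induction_on hf (fun a ha b hb => ?_) fun a b ha hb =>
      (le_min ha hb).trans min_order_le_add
    have hb' : 1 ≤ b.order := by
      rw [one_le_order_iff_constCoeff_eq_zero]
      have hle : Ideal.span (Set.range (X : σ → MvPowerSeries σ R)) ≤
          RingHom.ker (constantCoeff (σ := σ) (R := R)) := by
        rw [Ideal.span_le]
        rintro _ ⟨i, rfl⟩
        simp
      exact hle hb
    push_cast
    exact (add_le_add (ih ha) hb').trans le_order_mul

/-- A derivation mapping a generating set of an ideal into the ideal preserves the ideal. -/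
theorem Derivation.apply_mem_span_of_forall_mem {R A : Type*} [CommRing R] [CommRing A]
    [Algebra R A] (D : Derivation R A A) {s : Set A} (hs : ∀ a ∈ s, D a ∈ Ideal.span s)
    {a : A} (ha : a ∈ Ideal.span s) : D a ∈ Ideal.span s := by
  induction ha using Submodule.span_induction with
  | mem x hx => exact hs x hx
  | zero => simp
  | add x y _ _ hx hy => simpa using Ideal.add_mem _ hx hy
  | smul c x hxs hx =>
    rw [smul_eq_mul, D.leibniz, smul_eq_mul, smul_eq_mul]
    exact Ideal.add_mem _ (Ideal.mul_mem_left _ _ hx) (Ideal.mul_mem_right _ _ hxs)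

/-- A derivation preserving an ideal preserves all its powers. -/
theorem Derivation.apply_mem_pow_of_forall_mem {R A : Type*} [CommRing R] [CommRing A]
    [Algebra R A] (D : Derivation R A A) {I : Ideal A} (hI : ∀ a ∈ I, D a ∈ I) (k : ℕ)
    {a : A} (ha : a ∈ I ^ k) : D a ∈ I ^ k := by
  induction k generalizing a with
  | zero => simp
  | succ k ih =>
    rw [pow_succ] at ha ⊢
    refine Submodule.mul_induction_on ha (fun x hx y hy => ?_) fun x y hx hy => ?_
    · rw [D.leibniz, smul_eq_mul, smul_eq_mul, mul_comm y]
      exact Ideal.add_mem _ (Ideal.mul_mem_mul hx (hI y hy)) (Ideal.mul_mem_mul (ih hx) hy)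
    · rw [map_add]
      exact Ideal.add_mem _ hx hy

/-- Let `R = ℂ[[x₁,…,xₙ]]` with maximal ideal `𝔪`, let `ℓ ≥ 2`, and set `R̄ = R/𝔪^{ℓ+1}`
with `𝔪̄` the image of `𝔪` in `R̄`. Then every `ℂ`-linear derivation of `R̄` preserves
`𝔪̄^i` for every `i ≥ 1`; i.e. `Der_ℂ R̄ = Der_{𝔪̄^i} R̄` for all `i ≥ 1`. -/
theorem derivation_truncation_preserves_pow
    (n : ℕ)
    (𝔪 : Ideal (MvPowerSeries (Fin n) ℂ))
    (h𝔪 : 𝔪 = Ideal.span (Set.range (MvPowerSeries.X : Fin n → MvPowerSeries (Fin n) ℂ)))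
    (ℓ : ℕ) (hℓ : 2 ≤ ℓ)
    (δ : Derivation ℂ (MvPowerSeries (Fin n) ℂ ⧸ 𝔪 ^ (ℓ + 1))
      (MvPowerSeries (Fin n) ℂ ⧸ 𝔪 ^ (ℓ + 1)))
    (i : ℕ) (hi : 1 ≤ i) :
    ∀ a ∈ (𝔪.map (Ideal.Quotient.mk (𝔪 ^ (ℓ + 1)))) ^ i,
      δ a ∈ (𝔪.map (Ideal.Quotient.mk (𝔪 ^ (ℓ + 1)))) ^ i := by
  have hX : ∀ j, δ (Ideal.Quotient.mk (𝔪 ^ (ℓ + 1)) (MvPowerSeries.X j)) ∈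
      𝔪.map (Ideal.Quotient.mk (𝔪 ^ (ℓ + 1))) := by
    intro j
    obtain ⟨g, hg⟩ := Ideal.Quotient.mk_surjective
      (δ (Ideal.Quotient.mk (𝔪 ^ (ℓ + 1)) (MvPowerSeries.X j)))
    have hXm : (MvPowerSeries.X j : MvPowerSeries (Fin n) ℂ) ∈ 𝔪 :=
      h𝔪 ▸ Ideal.subset_span ⟨j, rfl⟩
    have hpow : Ideal.Quotient.mk (𝔪 ^ (ℓ + 1)) (MvPowerSeries.X j) ^ (ℓ + 1) = 0 := by
      rw [← map_pow]
      exact Ideal.Quotient.eq_zero_iff_mem.mpr (Ideal.pow_mem_pow hXm _)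
    have hδ := δ.leibniz_pow (a := Ideal.Quotient.mk (𝔪 ^ (ℓ + 1)) (MvPowerSeries.X j)) (ℓ + 1)
    rw [hpow, map_zero, ← hg, Nat.add_sub_cancel, smul_eq_mul, ← map_pow, ← map_mul,
      ← map_nsmul] at hδ
    have hmem := Ideal.Quotient.eq_zero_iff_mem.mp hδ.symm
    rw [h𝔪] at hmem
    have hord := MvPowerSeries.le_order_of_mem_span_range_X_pow _ hmem
    have hcoeff := MvPowerSeries.coeff_of_lt_order (d := Finsupp.single j ℓ)
      (lt_of_lt_of_le (by simpa using ENat.natCast_lt_natCast.mpr (Nat.lt_succ_self ℓ)) hord)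
    rw [map_nsmul, MvPowerSeries.X_pow_eq] at hcoeff
    have hsplit := MvPowerSeries.coeff_add_monomial_mul (Finsupp.single j ℓ) 0 g (1 : ℂ)
    rw [add_zero, one_mul] at hsplit
    rw [hsplit, smul_eq_zero] at hcoeff
    rw [← hg]
    refine Ideal.mem_map_of_mem _ ?_
    rw [h𝔪]
    exact MvPowerSeries.mem_span_range_X_of_constantCoeff_eq_zero
      (hcoeff.resolve_left (Nat.succ_ne_zero ℓ))
  intro a ha
  refine δ.apply_mem_pow_of_forall_mem (fun b hb => ?_) i ha
  have hspan : 𝔪.map (Ideal.Quotient.mk (𝔪 ^ (ℓ + 1))) =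
      Ideal.span (Ideal.Quotient.mk (𝔪 ^ (ℓ + 1)) '' Set.range MvPowerSeries.X) := by
    rw [← Ideal.map_span, ← h𝔪]
  rw [hspan] at hX hb ⊢
  refine δ.apply_mem_span_of_forall_mem ?_ hb
  rintro _ ⟨_, ⟨j, rfl⟩, rfl⟩
  exact hX j
end
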